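/- For every probability distribution P on 𝒳 and every fixed Δ ≥ 0, the inverse Marton exponent E ↦ R_M(E|Δ,P) is a continuous function of E on [0,∞), provided the distortion measure additionally satisfies max_{x∈𝒳} min_{y∈𝒴} d(x,y) = 0 and is not identically zero. -/

import Mathlib

open scoped BigOperators

/-- `p` is a probability distribution on the finite set `X`. -/
def IsDist {X : Type*} [Fintype X] (p : X → ℝ) : Prop :=
  (∀ x, 0 ≤ p x) ∧ ∑ x, p x = 1

/-- `V` is a conditional probability distribution on `Y` given `X`. -/
def IsCondDist {X Y : Type*} [Fintype Y] (V : X → Y → ℝ) : Prop :=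
  ∀ x, IsDist (V x)

/-- Mutual information `I(q,V)` with the convention `0 log 0 = 0`. -/
noncomputable def mutInfo {X Y : Type*} [Fintype X] [Fintype Y]
    (q : X → ℝ) (V : X → Y → ℝ) : ℝ :=
  ∑ x, ∑ y, if q x * V x y = 0 then 0
    else q x * V x y * Real.log (V x y / ∑ x', q x' * V x' y)

/-- The rate-distortion function `R(Δ|q)`. -/
noncomputable def rateDist {X Y : Type*} [Fintype X] [Fintype Y]
    (d : X → Y → ℝ) (Δ : ℝ) (q : X → ℝ) : ℝ :=
  sInf { r | ∃ V : X → Y → ℝ, IsCondDist V ∧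
    (∑ x, ∑ y, q x * V x y * d x y) ≤ Δ ∧ r = mutInfo q V }

/-- Relative entropy `D(q‖P)` (real-valued; convention `0 log 0 = 0`). -/
noncomputable def relEnt {X : Type*} [Fintype X] (q P : X → ℝ) : ℝ :=
  ∑ x, if q x = 0 then 0 else q x * Real.log (q x / P x)

/-- Absolute continuity: `q(x) = 0` whenever `P(x) = 0` (finiteness of `D(q‖P)`). -/
def AbsCont {X : Type*} (q P : X → ℝ) : Prop := ∀ x, P x = 0 → q x = 0

open Set

lemma IsDist.le_one {X : Type*} [Fintype X] {p : X → ℝ} (hp : IsDist p) (x : X) : p x ≤ 1 :=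
  hp.2 ▸ Finset.single_le_sum (fun x _ => hp.1 x) (Finset.mem_univ x)

lemma IsDist.mix {X : Type*} [Fintype X] {p q : X → ℝ} (hp : IsDist p) (hq : IsDist q)
    {t : ℝ} (ht0 : 0 ≤ t) (ht1 : t ≤ 1) : IsDist (fun x => (1 - t) * p x + t * q x) := by
  refine ⟨fun x => add_nonneg (mul_nonneg (by linarith) (hp.1 x)) (mul_nonneg ht0 (hq.1 x)), ?_⟩
  rw [Finset.sum_add_distrib, ← Finset.mul_sum, ← Finset.mul_sum, hp.2, hq.2]
  ring

/-- Mutual information as a difference of sums of `t log t` terms; continuous everywhere. -/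
noncomputable def mutInfoAux {X Y : Type*} [Fintype X] [Fintype Y]
    (z : (X → ℝ) × (X → Y → ℝ)) : ℝ :=
  (∑ x, ∑ y, z.1 x * (z.2 x y * Real.log (z.2 x y))) -
    ∑ y, (∑ x, z.1 x * z.2 x y) * Real.log (∑ x, z.1 x * z.2 x y)

lemma continuous_mutInfoAux {X Y : Type*} [Fintype X] [Fintype Y] :
    Continuous (mutInfoAux : (X → ℝ) × (X → Y → ℝ) → ℝ) := by
  unfold mutInfoAux
  refine Continuous.sub (continuous_finsetSum _ fun x _ => continuous_finsetSum _ fun y _ => ?_)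
    (continuous_finsetSum _ fun y _ => ?_)
  · exact Continuous.mul (by fun_prop) (Real.continuous_mul_log.comp
      (f := fun z : (X → ℝ) × (X → Y → ℝ) => z.2 x y) (by fun_prop))
  · exact Real.continuous_mul_log.comp
      (f := fun z : (X → ℝ) × (X → Y → ℝ) => ∑ x, z.1 x * z.2 x y) (by fun_prop)

lemma mutInfo_eq_mutInfoAux {X Y : Type*} [Fintype X] [Fintype Y] {q : X → ℝ} {V : X → Y → ℝ}
    (hq : IsDist q) (hV : IsCondDist V) : mutInfo q V = mutInfoAux (q, V) := by
  have h2 : ∑ y, (∑ x, q x * V x y) * Real.log (∑ x, q x * V x y) =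
      ∑ x, ∑ y, q x * V x y * Real.log (∑ x', q x' * V x' y) := by
    rw [Finset.sum_comm]
    exact Finset.sum_congr rfl fun y _ => Finset.sum_mul _ _ _
  simp only [mutInfoAux, mutInfo, h2, ← Finset.sum_sub_distrib]
  refine Finset.sum_congr rfl fun x _ => Finset.sum_congr rfl fun y _ => ?_
  split_ifs with h
  · rw [← mul_assoc, h]; ring
  · have hpos : 0 < q x * V x y := lt_of_le_of_ne (mul_nonneg (hq.1 x) ((hV x).1 y)) (Ne.symm h)
    have hs : 0 < ∑ x', q x' * V x' y := hpos.trans_le <|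
      Finset.single_le_sum (f := fun x' => q x' * V x' y)
        (fun x' _ => mul_nonneg (hq.1 x') ((hV x').1 y)) (Finset.mem_univ x)
    rw [Real.log_div (right_ne_zero_of_mul h) hs.ne']
    ring

lemma mutInfo_congr {X Y : Type*} [Fintype X] [Fintype Y] {q : X → ℝ} {V W : X → Y → ℝ}
    (h : ∀ x, q x ≠ 0 → V x = W x) : mutInfo q V = mutInfo q W := by
  have h' : ∀ x y, q x * V x y = q x * W x y := fun x y => by
    by_cases hx : q x = 0
    · simp [hx]
    · rw [h x hx]
  unfold mutInfo
  refine Finset.sum_congr rfl fun x _ => Finset.sum_congr rfl fun y _ => ?_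
  by_cases hx : q x = 0
  · simp [hx]
  · simp only [h', h x hx]

lemma mem_unitBox {X Y : Type*} [Fintype X] [Fintype Y] {q : X → ℝ} {V : X → Y → ℝ}
    (hq : IsDist q) (hV : IsCondDist V) :
    (q, V) ∈ Icc (0 : (X → ℝ) × (X → Y → ℝ)) 1 :=
  ⟨⟨hq.1, fun x => (hV x).1⟩, ⟨hq.le_one, fun x => (hV x).le_one⟩⟩

lemma exists_abs_mutInfo_le (X Y : Type*) [Fintype X] [Fintype Y] :
    ∃ C : ℝ, ∀ (q : X → ℝ) (V : X → Y → ℝ), IsDist q → IsCondDist V → |mutInfo q V| ≤ C := by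
  obtain ⟨C, hC⟩ := (isCompact_Icc (a := (0 : (X → ℝ) × (X → Y → ℝ)))
    (b := 1)).exists_bound_of_continuousOn continuous_mutInfoAux.continuousOn
  refine ⟨C, fun q V hq hV => ?_⟩
  rw [mutInfo_eq_mutInfoAux hq hV]
  exact hC _ (mem_unitBox hq hV)

lemma mutInfo_uniform (X Y : Type*) [Fintype X] [Fintype Y] {η : ℝ} (hη : 0 < η) :
    ∃ δ > 0, ∀ (q q' : X → ℝ) (V V' : X → Y → ℝ), IsDist q → IsDist q' → IsCondDist V →
      IsCondDist V' → dist q' q < δ → dist V' V < δ → mutInfo q' V' ≤ mutInfo q V + η := by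
  obtain ⟨δ, hδ, h⟩ := Metric.uniformContinuousOn_iff.1
    ((isCompact_Icc (a := (0 : (X → ℝ) × (X → Y → ℝ))) (b := 1)).uniformContinuousOn_of_continuous
      continuous_mutInfoAux.continuousOn) η hη
  refine ⟨δ, hδ, fun q q' V V' hq hq' hV hV' h1 h2 => ?_⟩
  have := h _ (mem_unitBox hq' hV') _ (mem_unitBox hq hV) (by
    rw [Prod.dist_eq]; exact max_lt h1 h2)
  rw [mutInfo_eq_mutInfoAux hq hV, mutInfo_eq_mutInfoAux hq' hV']
  rw [Real.dist_eq] at this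
  linarith [(abs_lt.1 this).2]

/-- A test channel that is feasible for `q` can be perturbed to one feasible for a nearby `q'`,
at a small price in mutual information. -/
lemma exists_feasible_near {X Y : Type*} [Fintype X] [Fintype Y]
    {d : X → Y → ℝ} (hd : ∀ x y, 0 ≤ d x y) {V₀ : X → Y → ℝ} (hV₀ : IsCondDist V₀)
    (hV₀d : ∀ x y, V₀ x y * d x y = 0) {Δ : ℝ} (hΔ : 0 ≤ Δ) {η : ℝ} (hη : 0 < η) :
    ∃ δ > 0, ∀ q q' : X → ℝ, IsDist q → IsDist q' → dist q' q < δ →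
      ∀ V : X → Y → ℝ, IsCondDist V → (∑ x, ∑ y, q x * V x y * d x y) ≤ Δ →
      ∃ V' : X → Y → ℝ, IsCondDist V' ∧ (∑ x, ∑ y, q' x * V' x y * d x y) ≤ Δ ∧
        mutInfo q' V' ≤ mutInfo q V + η := by
  classical
  obtain ⟨δ, hδ, hu⟩ := mutInfo_uniform X Y hη
  rcases hΔ.eq_or_lt with rfl | hΔ
  · refine ⟨δ, hδ, fun q q' hq hq' hqq V hV hc => ?_⟩
    have hnn : ∀ x y, 0 ≤ q x * V x y * d x y := fun x y =>
      mul_nonneg (mul_nonneg (hq.1 x) ((hV x).1 y)) (hd x y)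
    have hz : ∀ x y, q x * V x y * d x y = 0 := fun x y => by
      have h1 := Finset.single_le_sum (f := fun x => ∑ y, q x * V x y * d x y)
        (fun x _ => Finset.sum_nonneg fun y _ => hnn x y) (Finset.mem_univ x)
      have h2 := Finset.single_le_sum (f := fun y => q x * V x y * d x y)
        (fun y _ => hnn x y) (Finset.mem_univ y)
      exact le_antisymm (h2.trans (h1.trans hc)) (hnn x y)
    have hW : IsCondDist (fun x => if q x = 0 then V₀ x else V x) := fun x => by
      dsimp only
      split_ifs
      exacts [hV₀ x, hV x]
    refine ⟨_, hW, ?_, ?_⟩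
    · refine (Finset.sum_eq_zero fun x _ => Finset.sum_eq_zero fun y _ => ?_).le
      rw [mul_assoc]
      by_cases hx : q x = 0
      · simp only [hx, if_true, hV₀d, mul_zero]
      · have := hz x y
        rw [mul_assoc] at this
        simp only [hx, if_false, (mul_eq_zero.1 this).resolve_left hx, mul_zero]
    · rw [mutInfo_congr (q := q) (V := V) (W := fun x => if q x = 0 then V₀ x else V x)
        fun x hx => by simp [hx]]
      exact hu _ _ _ _ hq hq' hW hW hqq (by rwa [dist_self])
  · set C := ∑ x, ∑ y, d x y with hC
    have hC0 : 0 ≤ C := Finset.sum_nonneg fun x _ => Finset.sum_nonneg fun y _ => hd x y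
    obtain ⟨ε, hε0, hε1, hεδ⟩ : ∃ ε : ℝ, 0 < ε ∧ ε ≤ 1 ∧ ε < δ :=
      ⟨min 1 (δ / 2), lt_min one_pos (by linarith), min_le_left _ _,
        (min_le_right _ _).trans_lt (by linarith)⟩
    set γ := ε * Δ / (C + 1) with hγ
    have hγ0 : 0 < γ := by positivity
    have hγC : γ * C ≤ ε * Δ := by
      have : γ * (C + 1) = ε * Δ := by rw [hγ]; field_simp
      nlinarith
    refine ⟨min δ γ, lt_min hδ hγ0, fun q q' hq hq' hqq V hV hc => ?_⟩
    have hW : IsCondDist (fun x y => (1 - ε) * V x y + ε * V₀ x y) := fun x =>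
      (hV x).mix (hV₀ x) hε0.le hε1
    refine ⟨_, hW, ?_, hu _ _ _ _ hq hq' hV hW (hqq.trans_le (min_le_left _ _)) ?_⟩
    · have h1 : ∑ x, ∑ y, q' x * ((1 - ε) * V x y + ε * V₀ x y) * d x y =
          (1 - ε) * ∑ x, ∑ y, q' x * V x y * d x y := by
        simp only [Finset.mul_sum]
        refine Finset.sum_congr rfl fun x _ => Finset.sum_congr rfl fun y _ => ?_
        linear_combination q' x * ε * hV₀d x y
      have h2 : ∑ x, ∑ y, q' x * V x y * d x y ≤ Δ + γ * C := by
        have : ∑ x, ∑ y, q' x * V x y * d x y ≤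
            (∑ x, ∑ y, q x * V x y * d x y) + γ * C := by
          rw [hC]
          simp only [Finset.mul_sum, ← Finset.sum_add_distrib]
          refine Finset.sum_le_sum fun x _ => Finset.sum_le_sum fun y _ => ?_
          have hx : q' x - q x ≤ γ := by
            have := (dist_le_pi_dist q' q x).trans (hqq.le.trans (min_le_right _ _))
            rw [Real.dist_eq] at this
            exact (abs_le.1 this).2
          have h3 : (q' x - q x) * V x y ≤ γ :=
            (mul_le_mul_of_nonneg_right hx ((hV x).1 y)).trans
              (mul_le_of_le_one_right hγ0.le ((hV x).le_one y))
          nlinarith [mul_le_mul_of_nonneg_right h3 (hd x y)]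
        linarith
      rw [h1]
      nlinarith [mul_le_mul_of_nonneg_left h2 (by linarith : 0 ≤ 1 - ε),
        mul_nonneg hε0.le (mul_nonneg hγ0.le hC0)]
    · refine lt_of_le_of_lt ((dist_pi_le_iff hε0.le).2 fun x => (dist_pi_le_iff hε0.le).2
        fun y => ?_) hεδ
      rw [Real.dist_eq, abs_le]
      have a1 := (hV x).1 y
      have a2 := (hV x).le_one y
      have a3 := (hV₀ x).1 y
      have a4 := (hV₀ x).le_one y
      constructor <;> nlinarith

lemma bddBelow_mutInfo {X Y : Type*} [Fintype X] [Fintype Y] (d : X → Y → ℝ) (Δ : ℝ)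
    {q : X → ℝ} (hq : IsDist q) :
    BddBelow { r | ∃ V : X → Y → ℝ, IsCondDist V ∧
      (∑ x, ∑ y, q x * V x y * d x y) ≤ Δ ∧ r = mutInfo q V } := by
  obtain ⟨C, hC⟩ := exists_abs_mutInfo_le X Y
  refine ⟨-C, ?_⟩
  rintro r ⟨V, hV, -, rfl⟩
  exact (abs_le.1 (hC q V hq hV)).1

lemma sum_distortion_le {X Y : Type*} [Fintype X] [Fintype Y] {d : X → Y → ℝ}
    {V₀ : X → Y → ℝ} (hV₀d : ∀ x y, V₀ x y * d x y = 0) {Δ : ℝ} (hΔ : 0 ≤ Δ) (q : X → ℝ) :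
    (∑ x, ∑ y, q x * V₀ x y * d x y) ≤ Δ := by
  simpa [mul_assoc, hV₀d] using hΔ

lemma rateDist_uniform {X Y : Type*} [Fintype X] [Fintype Y]
    {d : X → Y → ℝ} (hd : ∀ x y, 0 ≤ d x y) {V₀ : X → Y → ℝ} (hV₀ : IsCondDist V₀)
    (hV₀d : ∀ x y, V₀ x y * d x y = 0) {Δ : ℝ} (hΔ : 0 ≤ Δ) {η : ℝ} (hη : 0 < η) :
    ∃ δ > 0, ∀ q q' : X → ℝ, IsDist q → IsDist q' → dist q' q < δ →
      rateDist d Δ q' ≤ rateDist d Δ q + η := by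
  obtain ⟨δ, hδ, h⟩ := exists_feasible_near hd hV₀ hV₀d hΔ hη
  refine ⟨δ, hδ, fun q q' hq hq' hqq => ?_⟩
  rw [← sub_le_iff_le_add]
  refine le_csInf ⟨_, V₀, hV₀, sum_distortion_le hV₀d hΔ q, rfl⟩ ?_
  rintro r ⟨V, hV, hc, rfl⟩
  obtain ⟨V', hV', hc', hI⟩ := h q q' hq hq' hqq V hV hc
  rw [sub_le_iff_le_add]
  exact (csInf_le (bddBelow_mutInfo d Δ hq') ⟨V', hV', hc', rfl⟩).trans hI

lemma exists_rateDist_le {X Y : Type*} [Fintype X] [Fintype Y]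
    {d : X → Y → ℝ} {V₀ : X → Y → ℝ} (hV₀ : IsCondDist V₀)
    (hV₀d : ∀ x y, V₀ x y * d x y = 0) {Δ : ℝ} (hΔ : 0 ≤ Δ) :
    ∃ C : ℝ, ∀ q : X → ℝ, IsDist q → rateDist d Δ q ≤ C := by
  obtain ⟨C, hC⟩ := exists_abs_mutInfo_le X Y
  exact ⟨C, fun q hq => (csInf_le (bddBelow_mutInfo d Δ hq)
    ⟨V₀, hV₀, sum_distortion_le hV₀d hΔ q, rfl⟩).trans (abs_le.1 (hC q V₀ hq hV₀)).2⟩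

lemma relEnt_self {X : Type*} [Fintype X] (P : X → ℝ) : relEnt P P = 0 := by
  refine Finset.sum_eq_zero fun x _ => ?_
  split_ifs with h
  · rfl
  · rw [div_self h, Real.log_one, mul_zero]

/-- Convexity of the relative entropy along the segment from `q` to `P`. -/
lemma relEnt_mix_le {X : Type*} [Fintype X] {P q : X → ℝ} (hP : IsDist P) (hq : IsDist q)
    {t : ℝ} (ht0 : 0 ≤ t) (ht1 : t ≤ 1) :
    relEnt (fun x => (1 - t) * q x + t * P x) P ≤ (1 - t) * relEnt q P := by
  have key : ∀ (r : X → ℝ), relEnt r P =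
      ∑ x, r x * Real.log (r x / P x) := fun r => by
    refine Finset.sum_congr rfl fun x _ => ?_
    split_ifs with h
    · simp [h]
    · rfl
  rw [key, key, Finset.mul_sum]
  refine Finset.sum_le_sum fun x _ => ?_
  rcases (hP.1 x).eq_or_lt with h0 | hpos
  · simp [← h0]
  · have := Real.convexOn_mul_log.2 (mem_Ici.2 (div_nonneg (hq.1 x) hpos.le))
      (mem_Ici.2 zero_le_one) (by linarith : 0 ≤ 1 - t) ht0 (by ring)
    simp only [smul_eq_mul, Real.log_one, mul_zero, add_zero, mul_one] at this
    have e : ((1 - t) * q x + t * P x) / P x = (1 - t) * (q x / P x) + t := by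
      field_simp
    rw [e]
    calc _ = P x * (((1 - t) * (q x / P x) + t) * Real.log ((1 - t) * (q x / P x) + t)) := by
          field_simp
      _ ≤ P x * ((1 - t) * (q x / P x * Real.log (q x / P x))) :=
          mul_le_mul_of_nonneg_left this hpos.le
      _ = _ := by field_simp

/-- A coordinatewise Pinsker-type inequality, via the Hellinger distance. -/
lemma sq_sub_le_relEnt {X : Type*} [Fintype X] {P q : X → ℝ} (hP : IsDist P) (hq : IsDist q)
    (hqP : AbsCont q P) (x : X) : (q x - P x) ^ 2 ≤ 4 * relEnt q P := by
  have hterm : ∀ x, (√(q x) - √(P x)) ^ 2 ≤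
      (if q x = 0 then 0 else q x * Real.log (q x / P x)) - q x + P x := fun x => by
    have hsP := Real.sq_sqrt (hP.1 x)
    have hsq := Real.sq_sqrt (hq.1 x)
    split_ifs with h
    · rw [h, Real.sqrt_zero]; nlinarith
    · have hq0 : 0 < q x := lt_of_le_of_ne (hq.1 x) (Ne.symm h)
      have hP0 : 0 < P x := lt_of_le_of_ne (hP.1 x) (fun h0 => h (hqP x h0.symm))
      have ha := Real.sqrt_pos.2 hq0
      have hb := Real.sqrt_pos.2 hP0
      have hl := Real.one_sub_inv_le_log_of_pos (div_pos ha hb)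
      have e : Real.log (q x / P x) = 2 * Real.log (√(q x) / √(P x)) := by
        rw [← Real.sqrt_div hq0.le, Real.log_sqrt (div_pos hq0 hP0).le]; ring
      have h3 := mul_le_mul_of_nonneg_left hl hq0.le
      have h4 : q x * (1 - (√(q x) / √(P x))⁻¹) = q x - √(q x) * √(P x) := by
        rw [inv_div]
        nth_rewrite 1 [← hsq]
        field_simp
        nlinarith
      rw [e]
      nlinarith
  have hsum : (√(q x) - √(P x)) ^ 2 ≤ relEnt q P := by
    have h1 : (√(q x) - √(P x)) ^ 2 ≤ ∑ x, (√(q x) - √(P x)) ^ 2 :=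
      Finset.single_le_sum (f := fun x => (√(q x) - √(P x)) ^ 2)
        (fun x _ => sq_nonneg _) (Finset.mem_univ x)
    have h2 := Finset.sum_le_sum fun x (_ : x ∈ Finset.univ) => hterm x
    rw [Finset.sum_add_distrib, Finset.sum_sub_distrib, hq.2, hP.2] at h2
    unfold relEnt
    linarith
  have hs : (√(q x) + √(P x)) ^ 2 ≤ 4 := by
    have := Real.sqrt_le_one.2 (hq.le_one x)
    have := Real.sqrt_le_one.2 (hP.le_one x)
    nlinarith [Real.sqrt_nonneg (q x), Real.sqrt_nonneg (P x)]
  have e : (q x - P x) ^ 2 = (√(q x) + √(P x)) ^ 2 * (√(q x) - √(P x)) ^ 2 := by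
    rw [← mul_pow, ← sq_sub_sq, Real.sq_sqrt (hP.1 x), Real.sq_sqrt (hq.1 x)]
  rw [e]
  exact mul_le_mul hs hsum (sq_nonneg _) (by norm_num)

/-- Points of a divergence ball are close to any slightly smaller divergence ball. -/
lemma exists_near_relEnt_le {X : Type*} [Fintype X] {P q : X → ℝ} (hP : IsDist P)
    (hq : IsDist q) (hqP : AbsCont q P) {E E' t : ℝ} (hE : 0 ≤ E) (hqE : relEnt q P ≤ E')
    (ht0 : 0 ≤ t) (ht : (1 - t) * E' ≤ E) :
    ∃ q', IsDist q' ∧ AbsCont q' P ∧ relEnt q' P ≤ E ∧ dist q' q ≤ t := by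
  rcases le_total t 1 with ht1 | ht1
  · refine ⟨_, hq.mix hP ht0 ht1, fun x hx => by simp [hx, hqP x hx],
      (relEnt_mix_le hP hq ht0 ht1).trans
        ((mul_le_mul_of_nonneg_left hqE (by linarith)).trans ht),
      (dist_pi_le_iff ht0).2 fun x => ?_⟩
    rw [Real.dist_eq, abs_le]
    have a1 := hq.1 x
    have a2 := hq.le_one x
    have a3 := hP.1 x
    have a4 := hP.le_one x
    constructor <;> nlinarith
  · refine ⟨P, hP, fun x hx => hx, (relEnt_self P).trans_le hE,
      (dist_pi_le_iff ht0).2 fun x => ?_⟩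
    rw [Real.dist_eq, abs_le]
    have a1 := hq.1 x
    have a2 := hq.le_one x
    have a3 := hP.1 x
    have a4 := hP.le_one x
    constructor <;> linarith

/-- Divergence balls depend continuously on the radius, in the Hausdorff sense. -/
lemma relEnt_ball_near {X : Type*} [Fintype X] {P : X → ℝ} (hP : IsDist P)
    {E : ℝ} (hE : 0 ≤ E) {δ : ℝ} (hδ : 0 < δ) :
    ∃ γ > 0, ∀ E', 0 ≤ E' → |E' - E| < γ → ∀ a b, (a = E ∧ b = E' ∨ a = E' ∧ b = E) →
      ∀ q, IsDist q → AbsCont q P → relEnt q P ≤ b →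
      ∃ q', IsDist q' ∧ AbsCont q' P ∧ relEnt q' P ≤ a ∧ dist q' q < δ := by
  rcases hE.eq_or_lt with rfl | hE
  · refine ⟨(δ / 4) ^ 2, by positivity, fun E' hE' hEE a b hab q hq hqP hqb => ?_⟩
    rw [sub_zero, abs_of_nonneg hE'] at hEE
    rcases hab with ⟨rfl, rfl⟩ | ⟨rfl, rfl⟩
    · refine ⟨P, hP, fun x hx => hx, (relEnt_self P).le,
        lt_of_le_of_lt ((dist_pi_le_iff (by positivity : 0 ≤ δ / 2)).2 fun x => ?_)
          (half_lt_self hδ)⟩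
      rw [dist_comm, Real.dist_eq]
      refine abs_le_of_sq_le_sq ?_ (by positivity)
      have := sq_sub_le_relEnt hP hq hqP x
      nlinarith
    · exact ⟨q, hq, hqP, hqb.trans hE', by rwa [dist_self]⟩
  · refine ⟨min (E / 2) (E * δ / 4), by positivity, fun E' hE' hEE a b hab q hq hqP hqb => ?_⟩
    obtain ⟨h1, h2⟩ := abs_lt.1 (hEE.trans_le (min_le_left _ _))
    obtain ⟨h3, h4⟩ := abs_lt.1 (hEE.trans_le (min_le_right _ _))
    obtain ⟨q', h⟩ := exists_near_relEnt_le (E := a) (E' := b) (t := δ / 2) hP hq hqP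
      (by rcases hab with ⟨rfl, rfl⟩ | ⟨rfl, rfl⟩ <;> linarith) hqb (by positivity)
      (by rcases hab with ⟨rfl, rfl⟩ | ⟨rfl, rfl⟩ <;> nlinarith)
    exact ⟨q', h.1, h.2.1, h.2.2.1, h.2.2.2.trans_lt (half_lt_self hδ)⟩

/-- Property 1d: the inverse Marton exponent is continuous in `E` on `[0,∞)`. -/
theorem inverse_marton_continuous
    {X Y : Type*} [Fintype X] [Fintype Y] [Nonempty X] [Nonempty Y]
    (P : X → ℝ) (hP : IsDist P)
    (d : X → Y → ℝ) (hd : ∀ x y, 0 ≤ d x y)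
    (hd0 : (⨆ x, ⨅ y, d x y) = 0) (hdne : ∃ x y, d x y ≠ 0)
    (Δ : ℝ) (hΔ : 0 ≤ Δ) :
    ContinuousOn
      (fun E : ℝ => sSup { r | ∃ q : X → ℝ, IsDist q ∧ AbsCont q P ∧
        relEnt q P ≤ E ∧ r = rateDist d Δ q })
      (Set.Ici (0 : ℝ)) := by
  classical
  have hzero : ∀ x, ∃ y, d x y = 0 := fun x => by
    obtain ⟨y, hy⟩ := exists_eq_ciInf_of_finite (f := d x)
    refine ⟨y, le_antisymm ?_ (hd x y)⟩
    rw [hy, ← hd0]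
    exact le_ciSup (f := fun x => ⨅ y, d x y) (Set.finite_range _).bddAbove x
  choose f hf using hzero
  obtain ⟨V₀, hV₀, hV₀d⟩ : ∃ V₀ : X → Y → ℝ, IsCondDist V₀ ∧ ∀ x y, V₀ x y * d x y = 0 := by
    refine ⟨fun x y => if y = f x then 1 else 0, fun x => ⟨fun y => ?_, by simp⟩, fun x y => ?_⟩
    · dsimp only
      split_ifs <;> norm_num
    · dsimp only
      split_ifs with h
      · rw [h, hf, mul_zero]
      · rw [zero_mul]
  obtain ⟨C, hC⟩ := exists_rateDist_le hV₀ hV₀d hΔ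
  have hbdd : ∀ E : ℝ, BddAbove { r | ∃ q : X → ℝ, IsDist q ∧ AbsCont q P ∧
      relEnt q P ≤ E ∧ r = rateDist d Δ q } := fun E => by
    refine ⟨C, ?_⟩
    rintro r ⟨q, hq, -, -, rfl⟩
    exact hC q hq
  rw [Metric.continuousOn_iff]
  intro E hE η hη
  obtain ⟨δ, hδ, hR⟩ := rateDist_uniform hd hV₀ hV₀d hΔ (half_pos hη)
  obtain ⟨γ, hγ, hnear⟩ := relEnt_ball_near hP (mem_Ici.1 hE) hδ
  refine ⟨γ, hγ, fun E' hE' hEE => ?_⟩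
  rw [Real.dist_eq] at hEE
  have main : ∀ a b, (a = E ∧ b = E' ∨ a = E' ∧ b = E) →
      sSup { r | ∃ q : X → ℝ, IsDist q ∧ AbsCont q P ∧ relEnt q P ≤ b ∧ r = rateDist d Δ q } ≤
      sSup { r | ∃ q : X → ℝ, IsDist q ∧ AbsCont q P ∧ relEnt q P ≤ a ∧ r = rateDist d Δ q }
        + η / 2 := by
    intro a b hab
    have hb : 0 ≤ b := by
      rcases hab with ⟨-, rfl⟩ | ⟨-, rfl⟩
      exacts [hE', hE]
    refine csSup_le ⟨_, P, hP, fun x hx => hx, (relEnt_self P).trans_le hb, rfl⟩ ?_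
    rintro r ⟨q, hq, hqP, hqb, rfl⟩
    obtain ⟨q', hq', hqP', hqa, hdist⟩ := hnear E' hE' hEE a b hab q hq hqP hqb
    have h1 := hR q' q hq' hq (by rwa [dist_comm])
    have h2 := le_csSup (hbdd a) ⟨q', hq', hqP', hqa, rfl⟩
    linarith
  have h1 := main E E' (Or.inl ⟨rfl, rfl⟩)
  have h2 := main E' E (Or.inr ⟨rfl, rfl⟩)
  rw [Real.dist_eq, abs_lt]
  constructor <;> linarith
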